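/- arXiv:2401.17763 — 5 statements merged into one kernel-verified Lean document; each statement's English description precedes it below -/
import Mathlib

section
/- Assume the EM decomposition and the Gibbs inequality, and fix θ' = (γ', z') ∈ Θ. If the function γ ↦ g((γ, z'); θ') is differentiable at γ', then its gradient at γ' is zero. Consequently, if moreover γ ↦ L(γ, z') and γ ↦ Q((γ, z'); θ') are differentiable at γ', then the gradient of γ ↦ L(γ, z') at γ' equals the gradient of γ ↦ Q((γ, z'); θ') at γ'. -/
open Filter Topology

/-- Under the EM decomposition and the Gibbs inequality, for a fixed
`θ' = (γ', z') ∈ Θ`: if `γ ↦ g((γ, z'); θ')` is differentiable at `γ'`, then its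
gradient (Fréchet derivative) at `γ'` vanishes; consequently, if moreover
`γ ↦ L(γ, z')` and `γ ↦ Q((γ, z'); θ')` are differentiable at `γ'`, then the
gradient of `γ ↦ L(γ, z')` at `γ'` equals that of `γ ↦ Q((γ, z'); θ')`. -/
theorem em_g_gradient_zero_and_gradL_eq_gradQ {N K : ℕ}
    (H : Set (Fin K → ℝ)) (hH : H.Finite)
    (L : (Fin N → ℝ) × (Fin K → ℝ) → ℝ)
    (Q g : ((Fin N → ℝ) × (Fin K → ℝ)) → ((Fin N → ℝ) × (Fin K → ℝ)) → ℝ)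
    (hdecomp : ∀ θ θ' : (Fin N → ℝ) × (Fin K → ℝ),
      θ.2 ∈ H → θ'.2 ∈ H → L θ = Q θ θ' + g θ θ')
    (hgibbs : ∀ θ θ' : (Fin N → ℝ) × (Fin K → ℝ),
      θ.2 ∈ H → θ'.2 ∈ H → g θ' θ' ≤ g θ θ')
    (γ' : Fin N → ℝ) (z' : Fin K → ℝ) (hz' : z' ∈ H) :
    (DifferentiableAt ℝ (fun γ : Fin N → ℝ => g (γ, z') (γ', z')) γ' →
      fderiv ℝ (fun γ : Fin N → ℝ => g (γ, z') (γ', z')) γ' = 0) ∧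
    (DifferentiableAt ℝ (fun γ : Fin N → ℝ => g (γ, z') (γ', z')) γ' →
      DifferentiableAt ℝ (fun γ : Fin N → ℝ => L (γ, z')) γ' →
      DifferentiableAt ℝ (fun γ : Fin N → ℝ => Q (γ, z') (γ', z')) γ' →
      fderiv ℝ (fun γ : Fin N → ℝ => L (γ, z')) γ' =
        fderiv ℝ (fun γ : Fin N → ℝ => Q (γ, z') (γ', z')) γ') := by
  have fderiv_g : fderiv ℝ (fun γ : Fin N → ℝ => g (γ, z') (γ', z')) γ' = 0 :=
    IsLocalMin.fderiv_eq_zero (Eventually.of_forall fun γ => hgibbs (γ, z') (γ', z') hz' hz')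
  refine ⟨fun _ => fderiv_g, fun hg _ hQ => ?_⟩
  have hL : (fun γ : Fin N → ℝ => L (γ, z')) =
      fun γ => Q (γ, z') (γ', z') + g (γ, z') (γ', z') :=
    funext fun γ => hdecomp (γ, z') (γ', z') hz' hz'
  rw [hL, fderiv_fun_add hQ hg, fderiv_g, add_zero]
end

section
/- Assume the EM decomposition, the Gibbs inequality, and the EM iterate condition. Fix an index r and assume that the functions γ ↦ L(γ, z^(r)), γ ↦ Q((γ, z^(r)); θ^(r)) and γ ↦ g((γ, z^(r)); θ^(r)) are differentiable at γ^(r). If the gradient of γ ↦ L(γ, z^(r)) at γ^(r) is nonzero, then L(θ^(r+1)) > L(θ^(r)). -/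
open Filter Topology

/-- Under the EM decomposition, the Gibbs inequality and the EM
iterate condition, fix an index `r` and assume `γ ↦ L(γ, z^(r))`,
`γ ↦ Q((γ, z^(r)); θ^(r))` and `γ ↦ g((γ, z^(r)); θ^(r))` are differentiable at
`γ^(r)`. If the gradient of `γ ↦ L(γ, z^(r))` at `γ^(r)` is nonzero, then
`L(θ^(r+1)) > L(θ^(r))`. -/
theorem em_strict_increase {N K : ℕ}
    (H : Set (Fin K → ℝ)) (hH : H.Finite)
    (L : (Fin N → ℝ) × (Fin K → ℝ) → ℝ)
    (Q g : ((Fin N → ℝ) × (Fin K → ℝ)) → ((Fin N → ℝ) × (Fin K → ℝ)) → ℝ)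
    (hdecomp : ∀ θ θ' : (Fin N → ℝ) × (Fin K → ℝ),
      θ.2 ∈ H → θ'.2 ∈ H → L θ = Q θ θ' + g θ θ')
    (hgibbs : ∀ θ θ' : (Fin N → ℝ) × (Fin K → ℝ),
      θ.2 ∈ H → θ'.2 ∈ H → g θ' θ' ≤ g θ θ')
    (θseq : ℕ → (Fin N → ℝ) × (Fin K → ℝ))
    (hmem : ∀ r : ℕ, (θseq r).2 ∈ H)
    (hmax : ∀ (r : ℕ) (θ : (Fin N → ℝ) × (Fin K → ℝ)),
      θ.2 ∈ H → Q θ (θseq r) ≤ Q (θseq (r + 1)) (θseq r))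
    (r : ℕ)
    (hLdiff : DifferentiableAt ℝ
      (fun γ : Fin N → ℝ => L (γ, (θseq r).2)) (θseq r).1)
    (hQdiff : DifferentiableAt ℝ
      (fun γ : Fin N → ℝ => Q (γ, (θseq r).2) (θseq r)) (θseq r).1)
    (hgdiff : DifferentiableAt ℝ
      (fun γ : Fin N → ℝ => g (γ, (θseq r).2) (θseq r)) (θseq r).1)
    (hgrad : fderiv ℝ (fun γ : Fin N → ℝ => L (γ, (θseq r).2)) (θseq r).1 ≠ 0) :
    L (θseq r) < L (θseq (r + 1)) := by
  by_contra! hle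
  have hQmax : IsLocalMax (fun γ : Fin N → ℝ => Q (γ, (θseq r).2) (θseq r)) (θseq r).1 := by
    refine Eventually.of_forall fun γ => ?_
    have h₁ := hmax r (γ, (θseq r).2) (hmem r)
    have h₂ := hdecomp (θseq (r + 1)) (θseq r) (hmem _) (hmem r)
    have h₃ := hdecomp (θseq r) (θseq r) (hmem r) (hmem r)
    have h₄ := hgibbs (θseq (r + 1)) (θseq r) (hmem _) (hmem r)
    show Q (γ, (θseq r).2) (θseq r) ≤ Q (θseq r) (θseq r)
    linarith
  have hgmin : IsLocalMin (fun γ : Fin N → ℝ => g (γ, (θseq r).2) (θseq r)) (θseq r).1 :=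
    Eventually.of_forall fun γ => hgibbs (γ, (θseq r).2) (θseq r) (hmem r) (hmem r)
  have hL : (fun γ : Fin N → ℝ => L (γ, (θseq r).2)) =
      (fun γ => Q (γ, (θseq r).2) (θseq r)) + fun γ => g (γ, (θseq r).2) (θseq r) :=
    funext fun γ => hdecomp (γ, (θseq r).2) (θseq r) (hmem r) (hmem r)
  apply hgrad
  rw [hL, fderiv_add hQdiff hgdiff, hQmax.fderiv_eq_zero, hgmin.fderiv_eq_zero, add_zero]
end

section
/- (Theorem 1) Assume the EM decomposition, the Gibbs inequality, the EM iterate condition, Conditions (1)–(4), and that for every θ' ∈ Θ and z ∈ H the maps γ ↦ L(γ, z), γ ↦ Q((γ, z); θ') and γ ↦ g((γ, z); θ') are differentiable on ℝ^N. Then every limit point θ* = (γ*, z*) of the sequence (θ^(r))_{r≥1} belongs to the stationary set S* = {(γ, z) ∈ Θ : the gradient of γ' ↦ L(γ', z) at γ vanishes}, and L(θ*) equals the limit of the convergent sequence (L(θ^(r)))_{r≥0}; in particular, L is constant on the set of limit points of the iterates. -/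
open Filter Topology

/-- A convergent sequence in a finite set of a T1 space is eventually equal to its limit, which
lies in the set. -/
lemma Set.Finite.eventually_eq_of_tendsto {X : Type*} [TopologicalSpace X] [T1Space X]
    {s : Set X} (hs : s.Finite) {u : ℕ → X} {x : X} (hu : ∀ j, u j ∈ s)
    (hx : Tendsto u atTop (𝓝 x)) : x ∈ s ∧ ∀ᶠ j in atTop, u j = x := by
  refine ⟨hs.isClosed.mem_of_tendsto hx (Eventually.of_forall hu), ?_⟩
  have hopen : IsOpen (s \ {x})ᶜ := (hs.subset Set.sdiff_subset).isClosed.isOpen_compl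
  filter_upwards [hx (hopen.mem_nhds (by simp))] with j hj
  by_contra hne
  exact hj ⟨hu j, hne⟩

/-- A function on a product which is continuous in the first variable is sequentially continuous
along sequences whose second component stays in a finite set. -/
lemma Set.Finite.tendsto_of_continuous_fst {X Y Z : Type*} [TopologicalSpace X]
    [TopologicalSpace Y] [T1Space Y] [TopologicalSpace Z] {s : Set Y} (hs : s.Finite)
    {f : X × Y → Z} (hf : ∀ y ∈ s, Continuous fun x => f (x, y)) {u : ℕ → X × Y} {p : X × Y}
    (hu : ∀ j, (u j).2 ∈ s) (hp : Tendsto u atTop (𝓝 p)) :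
    Tendsto (fun j => f (u j)) atTop (𝓝 (f p)) := by
  obtain ⟨hps, heq⟩ := hs.eventually_eq_of_tendsto hu (hp.snd_nhds)
  refine (((hf p.2 hps).tendsto p.1).comp hp.fst_nhds).congr' ?_
  filter_upwards [heq] with j hj
  simp [← hj]

/-- Theorem 1: Under the EM decomposition, the Gibbs inequality,
the EM iterate condition, Conditions (1)–(4), and differentiability (for every
`θ' ∈ Θ` and `z ∈ H`) of `γ ↦ L(γ, z)`, `γ ↦ Q((γ, z); θ')` and `γ ↦ g((γ, z); θ')`
on `ℝ^N`: every limit point `θ* = (γ*, z*)` of `(θ^(r))_{r ≥ 1}` belongs to the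
stationary set `S* = {(γ, z) ∈ Θ : ∇_γ L(γ, z) = 0}`, and `L(θ*)` is the limit of
the convergent sequence `(L(θ^(r)))_{r ≥ 0}`; in particular, `L` is constant on
the set of limit points of the iterates. -/
theorem em_converges_to_stationary_points {N K : ℕ}
    (H : Set (Fin K → ℝ)) (hH : H.Finite)
    (L : (Fin N → ℝ) × (Fin K → ℝ) → ℝ)
    (Q g : ((Fin N → ℝ) × (Fin K → ℝ)) → ((Fin N → ℝ) × (Fin K → ℝ)) → ℝ)
    (G : ((Fin N → ℝ) × (Fin K → ℝ)) → Set ((Fin N → ℝ) × (Fin K → ℝ)))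
    -- 𝒢(θ) is the set of maximizers of θ'' ↦ Q(θ''; θ) over Θ
    (hG : ∀ θ : (Fin N → ℝ) × (Fin K → ℝ), G θ =
      {θ'' : (Fin N → ℝ) × (Fin K → ℝ) | θ''.2 ∈ H ∧
        ∀ θ''' : (Fin N → ℝ) × (Fin K → ℝ), θ'''.2 ∈ H → Q θ''' θ ≤ Q θ'' θ})
    (hGne : ∀ θ : (Fin N → ℝ) × (Fin K → ℝ), θ.2 ∈ H → (G θ).Nonempty)
    -- EM decomposition and Gibbs inequality
    (hdecomp : ∀ θ θ' : (Fin N → ℝ) × (Fin K → ℝ),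
      θ.2 ∈ H → θ'.2 ∈ H → L θ = Q θ θ' + g θ θ')
    (hgibbs : ∀ θ θ' : (Fin N → ℝ) × (Fin K → ℝ),
      θ.2 ∈ H → θ'.2 ∈ H → g θ' θ' ≤ g θ θ')
    -- EM iterate condition
    (θseq : ℕ → (Fin N → ℝ) × (Fin K → ℝ))
    (hmem : ∀ r : ℕ, (θseq r).2 ∈ H)
    (hiter : ∀ r : ℕ, θseq (r + 1) ∈ G (θseq r))
    -- Condition (1): L bounded above on Θ
    (hbdd : ∃ C : ℝ, ∀ θ : (Fin N → ℝ) × (Fin K → ℝ), θ.2 ∈ H → L θ ≤ C)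
    -- Condition (2): compact superlevel sets at the iterates
    (hcompact : ∀ r : ℕ, 1 ≤ r →
      IsCompact {θ : (Fin N → ℝ) × (Fin K → ℝ) | θ.2 ∈ H ∧ L (θseq r) ≤ L θ})
    -- Condition (3): closedness of 𝒢 with respect to the continuous part
    (hclosed : ∀ z ∈ H, ∀ (γs : ℕ → Fin N → ℝ) (γ : Fin N → ℝ)
      (ws : ℕ → (Fin N → ℝ) × (Fin K → ℝ)) (w : (Fin N → ℝ) × (Fin K → ℝ)),
      Tendsto γs atTop (𝓝 γ) → (∀ j : ℕ, ws j ∈ G (γs j, z)) →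
      Tendsto ws atTop (𝓝 w) → w ∈ G (γ, z))
    -- Condition (4): joint continuity of Q and continuity of L in the continuous part
    (hQcont : ∀ z ∈ H, ∀ z' ∈ H, Continuous
      (fun p : (Fin N → ℝ) × (Fin N → ℝ) => Q (p.1, z) (p.2, z')))
    (hLcont : ∀ z ∈ H, Continuous (fun γ : Fin N → ℝ => L (γ, z)))
    -- differentiability of L, Q(·; θ') and g(·; θ') in the continuous part
    (hLdiff : ∀ z ∈ H, Differentiable ℝ (fun γ : Fin N → ℝ => L (γ, z)))
    (hQdiff : ∀ θ' : (Fin N → ℝ) × (Fin K → ℝ), θ'.2 ∈ H → ∀ z ∈ H,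
      Differentiable ℝ (fun γ : Fin N → ℝ => Q (γ, z) θ'))
    (hgdiff : ∀ θ' : (Fin N → ℝ) × (Fin K → ℝ), θ'.2 ∈ H → ∀ z ∈ H,
      Differentiable ℝ (fun γ : Fin N → ℝ => g (γ, z) θ')) :
    (∀ θstar : (Fin N → ℝ) × (Fin K → ℝ),
      (∃ φ : ℕ → ℕ, StrictMono φ ∧ (∀ j : ℕ, 1 ≤ φ j) ∧
        Tendsto (fun j : ℕ => θseq (φ j)) atTop (𝓝 θstar)) →
      (θstar ∈ {θ : (Fin N → ℝ) × (Fin K → ℝ) | θ.2 ∈ H ∧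
          fderiv ℝ (fun γ : Fin N → ℝ => L (γ, θ.2)) θ.1 = 0} ∧
        Tendsto (fun r : ℕ => L (θseq r)) atTop (𝓝 (L θstar)))) ∧
    (∀ θ1 θ2 : (Fin N → ℝ) × (Fin K → ℝ),
      (∃ φ : ℕ → ℕ, StrictMono φ ∧ (∀ j : ℕ, 1 ≤ φ j) ∧
        Tendsto (fun j : ℕ => θseq (φ j)) atTop (𝓝 θ1)) →
      (∃ φ : ℕ → ℕ, StrictMono φ ∧ (∀ j : ℕ, 1 ≤ φ j) ∧
        Tendsto (fun j : ℕ => θseq (φ j)) atTop (𝓝 θ2)) →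
      L θ1 = L θ2) := by
  have hmono : Monotone fun r => L (θseq r) := by
    refine monotone_nat_of_le_succ fun r => ?_
    have hr := hiter r
    rw [hG] at hr
    have hQ := hr.2 (θseq r) (hmem r)
    have hg := hgibbs (θseq (r + 1)) (θseq r) (hmem _) (hmem _)
    rw [hdecomp (θseq r) (θseq r) (hmem _) (hmem _),
      hdecomp (θseq (r + 1)) (θseq r) (hmem _) (hmem _)]
    exact add_le_add hQ hg
  have hlim : ∀ (θ : (Fin N → ℝ) × (Fin K → ℝ)) (φ : ℕ → ℕ), StrictMono φ →
      Tendsto (fun j => θseq (φ j)) atTop (𝓝 θ) →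
      Tendsto (fun r => L (θseq r)) atTop (𝓝 (L θ)) := fun θ φ hφ hθ =>
    (tendsto_iff_tendsto_subseq_of_monotone hmono hφ.tendsto_atTop).2
      (hH.tendsto_of_continuous_fst hLcont (fun j => hmem (φ j)) hθ)
  refine ⟨?_, ?_⟩
  · rintro θ ⟨φ, hφ, -, hθ⟩
    refine ⟨?_, hlim θ φ hφ hθ⟩
    obtain ⟨hz, heq⟩ := hH.eventually_eq_of_tendsto (fun j => hmem (φ j)) hθ.snd_nhds
    obtain ⟨w, -, ψ, hψ, hw⟩ := (hcompact 1 le_rfl).tendsto_subseq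
      (x := fun j => θseq (φ j + 1)) fun j => ⟨hmem _, hmono (Nat.le_add_left 1 (φ j))⟩
    have hLw : L w = L θ := tendsto_nhds_unique
      (hlim w (fun j => φ (ψ j) + 1) (fun a b h => Nat.succ_lt_succ (hφ (hψ h))) hw)
      (hlim θ φ hφ hθ)
    have hwG : w ∈ G (θ.1, θ.2) := by
      obtain ⟨n, hn⟩ := eventually_atTop.1 heq
      have hshift : Tendsto (fun j => j + n) atTop atTop := tendsto_add_atTop_nat n
      refine hclosed θ.2 hz (fun j => (θseq (φ (ψ (j + n)))).1) θ.1
        (fun j => θseq (φ (ψ (j + n)) + 1)) w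
        ((hθ.fst_nhds.comp hψ.tendsto_atTop).comp hshift) (fun j => ?_) (hw.comp hshift)
      rw [← hn (ψ (j + n)) ((Nat.le_add_left n j).trans (hψ.le_apply))]
      exact hiter _
    rw [hG] at hwG
    obtain ⟨hwH, hwmax⟩ := hwG
    have hQle : Q w θ ≤ Q θ θ := by
      linarith [hdecomp w θ hwH hz, hdecomp θ θ hz hz, hgibbs w θ hwH hz]
    have hQ0 : fderiv ℝ (fun γ => Q (γ, θ.2) θ) θ.1 = 0 :=
      IsLocalMax.fderiv_eq_zero (Eventually.of_forall fun γ => (hwmax (γ, θ.2) hz).trans hQle)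
    have hg0 : fderiv ℝ (fun γ => g (γ, θ.2) θ) θ.1 = 0 :=
      IsLocalMin.fderiv_eq_zero (Eventually.of_forall fun γ => hgibbs (γ, θ.2) θ hz hz)
    have hsum : (fun γ => L (γ, θ.2)) = fun γ => Q (γ, θ.2) θ + g (γ, θ.2) θ :=
      funext fun γ => hdecomp (γ, θ.2) θ hz hz
    refine ⟨hz, ?_⟩
    rw [hsum, fderiv_fun_add (hQdiff θ hz θ.2 hz θ.1) (hgdiff θ hz θ.2 hz θ.1), hQ0, hg0, add_zero]
  · rintro θ₁ θ₂ ⟨φ₁, hφ₁, -, h₁⟩ ⟨φ₂, hφ₂, -, h₂⟩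
    exact tendsto_nhds_unique (hlim θ₁ φ₁ hφ₁ h₁) (hlim θ₂ φ₂ hφ₂ h₂)
end

section
/- Let M, K, n be positive integers, σ² > 0, and B ∈ ℝ^{M×(Kn)} a matrix whose columns are indexed by pairs (k, i) with k ∈ {1,…,K}, i ∈ {1,…,n}. Assume that for every i ∈ {1,…,n} there exists k ∈ {1,…,K} such that the (k, i)-th column of B is nonzero. Then the function γ ↦ log det(B·(I_K ⊗ diag(γ))·Bᵀ + σ²I_M), defined on the nonnegative orthant {γ ∈ ℝ^n : γ_i ≥ 0 for all i}, tends to +∞ as ‖γ‖ → ∞. -/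
open Matrix Real Kronecker Filter Topology

theorem one_add_sum_le_prod_one_add {ι : Type*} (s : Finset ι) {f : ι → ℝ}
    (hf : ∀ i ∈ s, 0 ≤ f i) : 1 + ∑ i ∈ s, f i ≤ ∏ i ∈ s, (1 + f i) := by
  classical
  induction s using Finset.induction_on with
  | empty => simp
  | insert a s ha ih =>
    rw [Finset.sum_insert ha, Finset.prod_insert ha]
    have h0 := hf a (Finset.mem_insert_self a s)
    have hs : ∀ i ∈ s, 0 ≤ f i := fun i hi => hf i (Finset.mem_insert_of_mem hi)
    have hsum : 0 ≤ ∑ i ∈ s, f i := Finset.sum_nonneg hs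
    nlinarith [ih hs, mul_nonneg h0 hsum,
      mul_le_mul_of_nonneg_left (ih hs) (by linarith : 0 ≤ 1 + f a)]

theorem Matrix.IsHermitian.det_add_smul_one {m : Type*} [Fintype m] [DecidableEq m]
    {A : Matrix m m ℝ} (hA : A.IsHermitian) (t : ℝ) :
    (A + t • (1 : Matrix m m ℝ)).det = ∏ i, (hA.eigenvalues i + t) := by
  have h := A.eval_charpoly (-t)
  rw [hA.charpoly_eq, Polynomial.eval_prod] at h
  have hneg : A + t • (1 : Matrix m m ℝ) = -(Matrix.scalar m (-t) - A) := by
    rw [Matrix.scalar_apply, ← Matrix.smul_one_eq_diagonal, neg_smul]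
    abel
  rw [hneg, Matrix.det_neg, ← h, ← Finset.card_univ, ← Finset.prod_const,
    ← Finset.prod_mul_distrib]
  refine Finset.prod_congr rfl fun i _ => ?_
  simp [add_comm]

theorem Matrix.PosSemidef.pow_mul_one_add_trace_div_le_det_add_smul_one {m : Type*} [Fintype m]
    [DecidableEq m] {A : Matrix m m ℝ} (hA : A.PosSemidef) {t : ℝ} (ht : 0 < t) :
    t ^ Fintype.card m * (1 + A.trace / t) ≤ (A + t • (1 : Matrix m m ℝ)).det := by
  rw [hA.isHermitian.det_add_smul_one, hA.isHermitian.trace_eq_sum_eigenvalues]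
  have hprod : ∏ i, (hA.isHermitian.eigenvalues i + t) =
      t ^ Fintype.card m * ∏ i, (1 + hA.isHermitian.eigenvalues i / t) := by
    rw [← Finset.card_univ, ← Finset.prod_const, ← Finset.prod_mul_distrib]
    refine Finset.prod_congr rfl fun i _ => ?_
    field_simp
    ring
  rw [hprod]
  gcongr
  simpa [Finset.sum_div] using one_add_sum_le_prod_one_add Finset.univ
    (f := fun i => hA.isHermitian.eigenvalues i / t)
    fun i _ => div_nonneg (hA.eigenvalues_nonneg i) ht.le

theorem EuclideanSpace.norm_le_sum_of_nonneg {ι : Type*} [Fintype ι] {x : EuclideanSpace ℝ ι}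
    (hx : ∀ i, 0 ≤ x i) : ‖x‖ ≤ ∑ i, x i := by
  refine le_of_sq_le_sq ?_ (Finset.sum_nonneg fun i _ => hx i)
  rw [EuclideanSpace.real_norm_sq_eq]
  exact Finset.sum_sq_le_sq_sum_of_nonneg fun i _ => hx i

theorem Matrix.trace_mul_one_kronecker_diagonal_mul_transpose {m κ ι : Type*} [Fintype m]
    [Fintype κ] [DecidableEq κ] [Fintype ι] [DecidableEq ι] (B : Matrix m (κ × ι) ℝ)
    (d : ι → ℝ) :
    (B * ((1 : Matrix κ κ ℝ) ⊗ₖ Matrix.diagonal d) * Bᵀ).trace =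
      ∑ i, (∑ k, ∑ r, B r (k, i) ^ 2) * d i := by
  rw [← Matrix.diagonal_one, Matrix.diagonal_kronecker_diagonal, Matrix.trace_mul_comm,
    ← Matrix.mul_assoc, Matrix.trace]
  simp only [Matrix.diag_apply, Matrix.mul_diagonal]
  simp only [Matrix.mul_apply, Matrix.transpose_apply,
    one_mul, Fintype.sum_prod_type, Finset.sum_mul]
  rw [Finset.sum_comm]
  simp only [sq]

/-- Let `B ∈ ℝ^{M×(Kn)}` (columns indexed by pairs `(k, i)`) be such
that for every `i` some column `(k, i)` of `B` is nonzero, and let `σ² > 0`. Then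
`γ ↦ log det(B·(I_K ⊗ diag γ)·Bᵀ + σ²I_M)`, defined on the nonnegative orthant,
tends to `+∞` as the Euclidean norm `‖γ‖ → ∞`. -/
theorem logdet_coercive {M K n : ℕ} (hM : 0 < M) (hK : 0 < K) (hn : 0 < n)
    (σ2 : ℝ) (hσ2 : 0 < σ2)
    (B : Matrix (Fin M) (Fin K × Fin n) ℝ)
    (hB : ∀ i : Fin n, ∃ k : Fin K, (fun r : Fin M => B r (k, i)) ≠ 0) :
    Tendsto
      (fun γ : EuclideanSpace ℝ (Fin n) =>
        Real.log (B * ((1 : Matrix (Fin K) (Fin K) ℝ) ⊗ₖ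
            Matrix.diagonal (fun i => γ i)) * Bᵀ
          + σ2 • (1 : Matrix (Fin M) (Fin M) ℝ)).det)
      ((Filter.comap (fun γ : EuclideanSpace ℝ (Fin n) => ‖γ‖) atTop) ⊓
        Filter.principal {γ : EuclideanSpace ℝ (Fin n) | ∀ i, 0 ≤ γ i})
      atTop := by
  have : Nonempty (Fin n) := ⟨⟨0, hn⟩⟩
  have hw : ∀ i, 0 < ∑ k, ∑ r, B r (k, i) ^ 2 := by
    intro i
    obtain ⟨k, hk⟩ := hB i
    obtain ⟨r, hr⟩ := Function.ne_iff.mp hk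
    refine Finset.sum_pos' (fun k _ => Finset.sum_nonneg fun r _ => sq_nonneg _)
      ⟨k, Finset.mem_univ k, ?_⟩
    exact Finset.sum_pos' (fun r _ => sq_nonneg _) ⟨r, Finset.mem_univ r, sq_pos_of_ne_zero hr⟩
  obtain ⟨j, hj⟩ := Finite.exists_min fun i => ∑ k, ∑ r, B r (k, i) ^ 2
  set c := ∑ k, ∑ r, B r (k, j) ^ 2
  have hc : 0 < c := hw j
  refine Real.tendsto_log_atTop.comp ?_
  have hlim : Tendsto (fun γ : EuclideanSpace ℝ (Fin n) => σ2 ^ M * (1 + c * ‖γ‖ / σ2))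
      (comap (fun γ : EuclideanSpace ℝ (Fin n) => ‖γ‖) atTop ⊓
        𝓟 {γ : EuclideanSpace ℝ (Fin n) | ∀ i, 0 ≤ γ i}) atTop :=
    Tendsto.const_mul_atTop (pow_pos hσ2 M) <| tendsto_atTop_add_const_left _ _ <|
      ((tendsto_comap.mono_left inf_le_left).const_mul_atTop hc).atTop_div_const hσ2
  refine tendsto_atTop_mono' _ ?_ hlim
  filter_upwards [mem_inf_of_right (mem_principal_self _)] with γ hγ
  have hpsd : (B * ((1 : Matrix (Fin K) (Fin K) ℝ) ⊗ₖ
      Matrix.diagonal (fun i => γ i)) * Bᵀ).PosSemidef := by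
    simpa using (Matrix.PosSemidef.one.kronecker
      (Matrix.PosSemidef.diagonal (d := fun i => γ i) hγ)).mul_mul_conjTranspose_same B
  have hdet := hpsd.pow_mul_one_add_trace_div_le_det_add_smul_one hσ2
  rw [Matrix.trace_mul_one_kronecker_diagonal_mul_transpose, Fintype.card_fin] at hdet
  refine le_trans ?_ hdet
  gcongr
  calc c * ‖γ‖ ≤ c * ∑ i, γ i := by
        gcongr
        exact EuclideanSpace.norm_le_sum_of_nonneg hγ
    _ ≤ _ := by
        rw [Finset.mul_sum]
        exact Finset.sum_le_sum fun i _ => mul_le_mul_of_nonneg_right (hj i) (hγ i)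
end

section
/- (Compact superlevel sets of the SBL cost) Assume the nondegeneracy condition: for every i ∈ {1,…,n} there exists k ∈ {1,…,K} such that the (k, i)-th column of the matrix (diag(z) ⊗ A)·D̃ is nonzero. Then for every c ∈ ℝ, the superlevel set {γ ∈ ℝ^n : γ_i ≥ 0 for all i, and L(γ, z) ≥ c} is compact. -/
open Matrix Real Kronecker Filter Topology

/-- The block lower-triangular matrix `D̃ ∈ ℝ^{Kn×Kn}` whose `(k, j)`-th `n×n`
block is `D^{k−j}` for `j ≤ k` and `0` otherwise. -/
noncomputable def Dtilde {n K : ℕ} (D : Matrix (Fin n) (Fin n) ℝ) :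
    Matrix (Fin K × Fin n) (Fin K × Fin n) ℝ :=
  fun p q =>
    if (q.1 : ℕ) ≤ (p.1 : ℕ) then (D ^ ((p.1 : ℕ) - (q.1 : ℕ))) p.2 q.2 else 0

/-- The covariance matrix
`R_Y(γ, z) = (diag z ⊗ A) · D̃ · (I_K ⊗ diag γ) · D̃ᵀ · (diag z ⊗ Aᵀ)`. -/
noncomputable def RY {n m K : ℕ} (A : Matrix (Fin m) (Fin n) ℝ)
    (D : Matrix (Fin n) (Fin n) ℝ) (z : Fin K → ℝ) (γ : Fin n → ℝ) :
    Matrix (Fin K × Fin m) (Fin K × Fin m) ℝ :=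
  ((((Matrix.diagonal z ⊗ₖ A) *
      (Dtilde D : Matrix (Fin K × Fin n) (Fin K × Fin n) ℝ)) *
    ((1 : Matrix (Fin K) (Fin K) ℝ) ⊗ₖ Matrix.diagonal γ)) *
    (Dtilde D : Matrix (Fin K × Fin n) (Fin K × Fin n) ℝ)ᵀ) *
    (Matrix.diagonal z ⊗ₖ Aᵀ)

/-- The SBL cost
`L(γ, z) = -(Km/2)·log(2π) - (1/2)·log det(R_Y(γ,z) + σ²I) - (1/2)·yᵀ(R_Y(γ,z) + σ²I)⁻¹y`. -/
noncomputable def Lsbl {n m K : ℕ} (A : Matrix (Fin m) (Fin n) ℝ)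
    (D : Matrix (Fin n) (Fin n) ℝ) (z : Fin K → ℝ) (y : Fin K × Fin m → ℝ)
    (σ2 : ℝ) (γ : Fin n → ℝ) : ℝ :=
  -(((K * m : ℕ) : ℝ) / 2) * Real.log (2 * π)
    - (1 / 2) * Real.log (RY A D z γ
        + σ2 • (1 : Matrix (Fin K × Fin m) (Fin K × Fin m) ℝ)).det
    - (1 / 2) * (y ⬝ᵥ (RY A D z γ
        + σ2 • (1 : Matrix (Fin K × Fin m) (Fin K × Fin m) ℝ))⁻¹ *ᵥ y)

lemma Finset.one_add_sum_le_prod_one_add_of_nonneg {ι : Type*} (s : Finset ι) (f : ι → ℝ)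
    (hf : ∀ i, 0 ≤ f i) : 1 + ∑ i ∈ s, f i ≤ ∏ i ∈ s, (1 + f i) := by
  classical
  induction s using Finset.induction_on with
  | empty => simp
  | insert a s ha ih =>
    rw [Finset.sum_insert ha, Finset.prod_insert ha]
    nlinarith [hf a, Finset.sum_nonneg fun i (_ : i ∈ s) => hf i,
      mul_le_mul_of_nonneg_left ih (hf a),
      mul_nonneg (hf a) (Finset.sum_nonneg fun i (_ : i ∈ s) => hf i)]

lemma Matrix.IsHermitian.det_add_smul_one_s12 {ι : Type*} [Fintype ι] [DecidableEq ι]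
    {R : Matrix ι ι ℝ} (hR : R.IsHermitian) (s : ℝ) :
    (R + s • (1 : Matrix ι ι ℝ)).det = ∏ i, (hR.eigenvalues i + s) := by
  have h := congrArg (Polynomial.eval (-s)) hR.charpoly_eq
  rw [Matrix.eval_charpoly, Polynomial.eval_prod] at h
  have h1 : Matrix.scalar ι (-s) - R = -(R + s • (1 : Matrix ι ι ℝ)) := by
    rw [Matrix.smul_one_eq_diagonal, Matrix.scalar_apply, neg_add, ← Matrix.diagonal_neg]
    abel_nf
  have h2 : ∀ i, Polynomial.eval (-s) (Polynomial.X - Polynomial.C (hR.eigenvalues i))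
      = -(hR.eigenvalues i + s) := fun i => by
    simp; ring
  simp only [RCLike.ofReal_real_eq_id, id_eq, h1, h2, Matrix.det_neg, Finset.prod_neg,
    Finset.card_univ] at h
  exact mul_left_cancel₀ (pow_ne_zero _ (by norm_num)) h

lemma Matrix.PosSemidef.mul_one_add_trace_le_det {ι : Type*} [Fintype ι] [DecidableEq ι]
    {R : Matrix ι ι ℝ} (hR : R.PosSemidef) {s : ℝ} (hs : 0 < s) :
    s ^ Fintype.card ι * (1 + R.trace / s) ≤ (R + s • (1 : Matrix ι ι ℝ)).det := by
  have htr : R.trace = ∑ i, hR.1.eigenvalues i := by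
    simpa using hR.1.trace_eq_sum_eigenvalues
  have hprod : ∏ i, (hR.1.eigenvalues i + s)
      = s ^ Fintype.card ι * ∏ i, (1 + hR.1.eigenvalues i / s) := by
    rw [← Finset.card_univ, ← Finset.prod_const, ← Finset.prod_mul_distrib]
    refine Finset.prod_congr rfl fun i _ => ?_
    field_simp
    ring
  rw [hR.1.det_add_smul_one_s12, hprod, htr, Finset.sum_div]
  exact mul_le_mul_of_nonneg_left (Finset.one_add_sum_le_prod_one_add_of_nonneg _ _
    fun i => div_nonneg (hR.eigenvalues_nonneg i) hs.le) (by positivity)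

lemma Matrix.PosSemidef.det_add_smul_one_pos {ι : Type*} [Fintype ι] [DecidableEq ι]
    {R : Matrix ι ι ℝ} (hR : R.PosSemidef) {s : ℝ} (hs : 0 < s) :
    0 < (R + s • (1 : Matrix ι ι ℝ)).det := by
  rw [hR.1.det_add_smul_one_s12]
  exact Finset.prod_pos fun i _ => add_pos_of_nonneg_of_pos (hR.eigenvalues_nonneg i) hs

lemma Matrix.PosSemidef.quadratic_inv_add_smul_one_nonneg {ι : Type*} [Fintype ι]
    [DecidableEq ι] {R : Matrix ι ι ℝ} (hR : R.PosSemidef) {s : ℝ} (hs : 0 < s) (y : ι → ℝ) :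
    0 ≤ y ⬝ᵥ (R + s • (1 : Matrix ι ι ℝ))⁻¹ *ᵥ y := by
  have h : (R + s • (1 : Matrix ι ι ℝ)).PosSemidef :=
    hR.add (Matrix.PosSemidef.one.smul hs.le)
  simpa using h.inv.dotProduct_mulVec_nonneg y

/-- The effective measurement matrix `(diag z ⊗ A) · D̃`. -/
noncomputable def sensing {n m K : ℕ} (A : Matrix (Fin m) (Fin n) ℝ)
    (D : Matrix (Fin n) (Fin n) ℝ) (z : Fin K → ℝ) :
    Matrix (Fin K × Fin m) (Fin K × Fin n) ℝ :=
  (Matrix.diagonal z ⊗ₖ A) * (Dtilde D : Matrix (Fin K × Fin n) (Fin K × Fin n) ℝ)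

lemma RY_eq {n m K : ℕ} (A : Matrix (Fin m) (Fin n) ℝ) (D : Matrix (Fin n) (Fin n) ℝ)
    (z : Fin K → ℝ) (γ : Fin n → ℝ) :
    RY A D z γ = sensing A D z
      * Matrix.diagonal (fun p : Fin K × Fin n => γ p.2)
      * (sensing A D z)ᵀ := by
  have h1 : (1 : Matrix (Fin K) (Fin K) ℝ) ⊗ₖ Matrix.diagonal γ
      = Matrix.diagonal (fun p : Fin K × Fin n => γ p.2) := by
    rw [← Matrix.diagonal_one, Matrix.diagonal_kronecker_diagonal]
    simp
  have h2 : (Matrix.diagonal z ⊗ₖ A)ᵀ = Matrix.diagonal z ⊗ₖ Aᵀ := by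
    rw [← Matrix.kroneckerMap_transpose, Matrix.diagonal_transpose]
  rw [RY, sensing, h1, Matrix.transpose_mul, h2]
  simp only [Matrix.mul_assoc]

lemma RY_posSemidef {n m K : ℕ} (A : Matrix (Fin m) (Fin n) ℝ) (D : Matrix (Fin n) (Fin n) ℝ)
    (z : Fin K → ℝ) {γ : Fin n → ℝ} (hγ : ∀ i, 0 ≤ γ i) : (RY A D z γ).PosSemidef := by
  rw [RY_eq]
  have h : (Matrix.diagonal (fun p : Fin K × Fin n => γ p.2)).PosSemidef :=
    Matrix.PosSemidef.diagonal fun p => hγ p.2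
  simpa using h.mul_mul_conjTranspose_same (sensing A D z)

lemma RY_trace {n m K : ℕ} (A : Matrix (Fin m) (Fin n) ℝ) (D : Matrix (Fin n) (Fin n) ℝ)
    (z : Fin K → ℝ) (γ : Fin n → ℝ) :
    (RY A D z γ).trace = ∑ r, ∑ p : Fin K × Fin n,
      γ p.2 * sensing A D z r p ^ 2 := by
  rw [RY_eq, Matrix.trace]
  refine Finset.sum_congr rfl fun r _ => ?_
  rw [Matrix.diag_apply, Matrix.mul_apply]
  refine Finset.sum_congr rfl fun p _ => ?_
  rw [Matrix.mul_diagonal, Matrix.transpose_apply]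
  ring

lemma mul_sq_le_RY_trace {n m K : ℕ} (A : Matrix (Fin m) (Fin n) ℝ)
    (D : Matrix (Fin n) (Fin n) ℝ) (z : Fin K → ℝ) {γ : Fin n → ℝ} (hγ : ∀ i, 0 ≤ γ i)
    (r : Fin K × Fin m) (p : Fin K × Fin n) :
    γ p.2 * sensing A D z r p ^ 2
      ≤ (RY A D z γ).trace := by
  rw [RY_trace]
  have h : ∀ r (p : Fin K × Fin n),
      0 ≤ γ p.2 * sensing A D z r p ^ 2 :=
    fun r p => mul_nonneg (hγ _) (sq_nonneg _)
  exact (Finset.single_le_sum (fun q _ => h r q) (Finset.mem_univ p)).trans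
    (Finset.single_le_sum (f := fun r => ∑ p : Fin K × Fin n,
      γ p.2 * sensing A D z r p ^ 2)
      (fun r _ => Finset.sum_nonneg fun q _ => h r q) (Finset.mem_univ r))

lemma continuous_RY {n m K : ℕ} (A : Matrix (Fin m) (Fin n) ℝ) (D : Matrix (Fin n) (Fin n) ℝ)
    (z : Fin K → ℝ) : Continuous (RY A D z) := by
  have h : RY A D z = fun γ => sensing A D z
      * Matrix.diagonal (fun p : Fin K × Fin n => γ p.2)
      * (sensing A D z)ᵀ := funext fun γ => RY_eq A D z γ
  rw [h]
  have hd : Continuous fun γ : Fin n → ℝ =>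
      Matrix.diagonal (fun p : Fin K × Fin n => γ p.2) :=
    Continuous.matrix_diagonal (by fun_prop)
  exact (continuous_const.matrix_mul hd).matrix_mul continuous_const

lemma continuousOn_Lsbl {n m K : ℕ} (A : Matrix (Fin m) (Fin n) ℝ)
    (D : Matrix (Fin n) (Fin n) ℝ) (z : Fin K → ℝ) (y : Fin K × Fin m → ℝ) {σ2 : ℝ}
    (hσ2 : 0 < σ2) : ContinuousOn (Lsbl A D z y σ2) {γ | ∀ i, 0 ≤ γ i} := by
  intro γ hγ
  refine ContinuousAt.continuousWithinAt ?_
  have hpos := (RY_posSemidef A D z hγ).det_add_smul_one_pos hσ2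
  have hM : Continuous fun γ =>
      RY A D z γ + σ2 • (1 : Matrix (Fin K × Fin m) (Fin K × Fin m) ℝ) :=
    (continuous_RY A D z).add continuous_const
  have hinv : ContinuousAt (fun γ =>
      (RY A D z γ + σ2 • (1 : Matrix (Fin K × Fin m) (Fin K × Fin m) ℝ))⁻¹) γ := by
    simp only [Matrix.inv_def, Ring.inverse_eq_inv']
    exact (hM.matrix_det.continuousAt.inv₀ hpos.ne').smul hM.matrix_adjugate.continuousAt
  have hquad : Continuous fun M : Matrix (Fin K × Fin m) (Fin K × Fin m) ℝ => y ⬝ᵥ M *ᵥ y :=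
    continuous_const.dotProduct (continuous_id.matrix_mulVec continuous_const)
  unfold Lsbl
  exact (continuousAt_const.sub
    (continuousAt_const.mul (hM.matrix_det.continuousAt.log hpos.ne'))).sub
    (continuousAt_const.mul (hquad.continuousAt.comp hinv))

lemma RY_trace_le_of_le_Lsbl {n m K : ℕ} (A : Matrix (Fin m) (Fin n) ℝ)
    (D : Matrix (Fin n) (Fin n) ℝ) (z : Fin K → ℝ) (y : Fin K × Fin m → ℝ) {σ2 : ℝ}
    (hσ2 : 0 < σ2) (c : ℝ) :
    ∃ B : ℝ, ∀ γ : Fin n → ℝ, (∀ i, 0 ≤ γ i) → c ≤ Lsbl A D z y σ2 γ →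
      (RY A D z γ).trace ≤ B := by
  refine ⟨(Real.exp (-(K * m : ℕ) * Real.log (2 * π) - 2 * c)
    / σ2 ^ Fintype.card (Fin K × Fin m)) * σ2, fun γ hγ hc => ?_⟩
  have hR := RY_posSemidef A D z hγ
  have hquad := hR.quadratic_inv_add_smul_one_nonneg hσ2 y
  have hdet := hR.mul_one_add_trace_le_det hσ2
  unfold Lsbl at hc
  have hlog : Real.log (RY A D z γ
      + σ2 • (1 : Matrix (Fin K × Fin m) (Fin K × Fin m) ℝ)).det
      ≤ -(K * m : ℕ) * Real.log (2 * π) - 2 * c := by linarith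
  have hexp := hdet.trans ((Real.log_le_iff_le_exp (hR.det_add_smul_one_pos hσ2)).1 hlog)
  have hpow : 0 < σ2 ^ Fintype.card (Fin K × Fin m) := pow_pos hσ2 _
  rw [← div_le_iff₀ hσ2, le_div_iff₀ hpow]
  linarith

/-- compact superlevel sets of the SBL cost: under the
nondegeneracy condition that for every `i` some column `(k, i)` of
`(diag z ⊗ A)·D̃` is nonzero, for every `c ∈ ℝ` the superlevel set
`{γ ∈ ℝ^n : γ ≥ 0 entrywise and L(γ, z) ≥ c}` is compact. -/
theorem Lsbl_superlevel_compact {n m K : ℕ} (hn : 0 < n) (hm : 0 < m) (hK : 0 < K)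
    (A : Matrix (Fin m) (Fin n) ℝ) (D : Matrix (Fin n) (Fin n) ℝ)
    (z : Fin K → ℝ) (hz : ∀ k, z k = 0 ∨ z k = 1)
    (y : Fin K × Fin m → ℝ) (σ2 : ℝ) (hσ2 : 0 < σ2)
    (hnondeg : ∀ i : Fin n, ∃ k : Fin K,
      (fun r : Fin K × Fin m =>
        ((Matrix.diagonal z ⊗ₖ A) *
          (Dtilde D : Matrix (Fin K × Fin n) (Fin K × Fin n) ℝ)) r (k, i)) ≠ 0)
    (c : ℝ) :
    IsCompact {γ : Fin n → ℝ | (∀ i, 0 ≤ γ i) ∧ c ≤ Lsbl A D z y σ2 γ} := by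
  obtain ⟨B, hB⟩ := RY_trace_le_of_le_Lsbl A D z y hσ2 c
  have hcol : ∀ i : Fin n, ∃ (k : Fin K) (r : Fin K × Fin m),
      sensing A D z r (k, i) ≠ 0 :=
    fun i => (hnondeg i).imp fun k hk => Function.ne_iff.1 hk
  choose k r hkr using hcol
  have hclosed : IsClosed {γ : Fin n → ℝ | ∀ i, 0 ≤ γ i} := by
    simp only [Set.ofPred_forall]
    exact isClosed_iInter fun i => isClosed_le continuous_const (continuous_apply i)
  refine (isCompact_Icc (a := (0 : Fin n → ℝ)) (b := fun i => B /
    sensing A D z (r i) (k i, i) ^ 2)).of_isClosed_subset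
    ((continuousOn_Lsbl A D z y hσ2).preimage_isClosed_of_isClosed hclosed isClosed_Ici)
    fun γ hγ => ⟨hγ.1, fun i => ?_⟩
  rw [le_div_iff₀ (sq_pos_of_ne_zero (hkr i))]
  exact (mul_sq_le_RY_trace A D z hγ.1 (r i) (k i, i)).trans (hB γ hγ.1 hγ.2)
end
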